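/- (Second generalized Kolotilina bound.) Let G be a finite simple graph on n vertices with at least one edge and chromatic number χ. Then for every m with 1 ≤ m ≤ n: Σ_{i=1}^m μ_i ≤ (χ − 1)·Σ_{i=1}^m (μ_i − δ_{n+1−i} + θ_{n+1−i}). -/

import Mathlib

open Matrix in
lemma weights_aux {ι : Type*} [Fintype ι] [DecidableEq ι] (s : Finset ι) (f c : ι → ℝ) (τ : ℝ)
    (h0 : ∀ i, 0 ≤ c i) (h1 : ∀ i, c i ≤ 1) (hs : ∑ i, c i = s.card)
    (hin : ∀ i ∈ s, f i ≤ τ) (hout : ∀ i, i ∉ s → τ ≤ f i) :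
    ∑ i ∈ s, f i ≤ ∑ i, c i * f i := by
  have key : 0 ≤ ∑ i, (c i - if i ∈ s then 1 else 0) * (f i - τ) := by
    apply Finset.sum_nonneg
    intro i _
    by_cases hi : i ∈ s
    · simp only [hi, if_true]
      nlinarith [h1 i, hin i hi]
    · simp only [hi, if_false]
      nlinarith [h0 i, hout i hi]
  have e1 : ∑ i, (c i - if i ∈ s then 1 else 0) * (f i - τ)
      = (∑ i, c i * f i - ∑ i ∈ s, f i) - ((∑ i, c i) * τ - s.card * τ) := by
    have : ∀ i, (c i - if i ∈ s then 1 else 0) * (f i - τ)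
        = (c i * f i - if i ∈ s then f i else 0) - (c i * τ - if i ∈ s then τ else 0) := by
      intro i; split_ifs <;> ring
    simp only [this, Finset.sum_sub_distrib, Finset.sum_mul]
    simp
  rw [e1, hs] at key
  linarith

open Matrix in
lemma spec_aux {n : ℕ} {H : Matrix (Fin n) (Fin n) ℝ} (hH : H.IsHermitian) (f : Fin n → ℝ)
    (hf : ∃ e : Equiv.Perm (Fin n), f = hH.eigenvalues ∘ e) :
    ∃ U : Matrix (Fin n) (Fin n) ℝ, U * Uᴴ = 1 ∧ Uᴴ * U = 1 ∧ H = U * diagonal f * Uᴴ := by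
  obtain ⟨e, rfl⟩ := hf
  obtain ⟨V, hV⟩ : ∃ V : Matrix (Fin n) (Fin n) ℝ, V = hH.eigenvectorUnitary.1 := ⟨_, rfl⟩
  have hV1 : V * Vᴴ = 1 := by
    have := Unitary.coe_mul_star_self hH.eigenvectorUnitary
    simpa [star_eq_conjTranspose, hV] using this
  have hV2 : Vᴴ * V = 1 := by
    have := Unitary.coe_star_mul_self hH.eigenvectorUnitary
    simpa [star_eq_conjTranspose, hV] using this
  have hs : H = V * diagonal hH.eigenvalues * Vᴴ := by
    have := hH.spectral_theorem
    rw [Unitary.conjStarAlgAut_apply] at this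
    simpa [star_eq_conjTranspose, hV] using this
  have hd : diagonal (hH.eigenvalues ∘ e) = (diagonal hH.eigenvalues).submatrix e e := by
    simp
  refine ⟨V.submatrix id e, ?_, ?_, ?_⟩
  · rw [conjTranspose_submatrix, submatrix_mul_equiv, hV1]; simp
  · rw [conjTranspose_submatrix, ← submatrix_mul _ _ _ id _ Function.bijective_id, hV2]; simp
  · rw [hd, conjTranspose_submatrix, submatrix_mul_equiv, submatrix_mul_equiv]
    simpa using hs

open Matrix in
/-- Trace of `H * M` as a weighted eigenvalue sum. -/
lemma trace_weights {n : ℕ} {H M : Matrix (Fin n) (Fin n) ℝ} (hH : H.IsHermitian) (f : Fin n → ℝ)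
    (hf : ∃ e : Equiv.Perm (Fin n), f = hH.eigenvalues ∘ e)
    (hM : M.PosSemidef) (hM' : (1 - M).PosSemidef) :
    ∃ c : Fin n → ℝ, (∀ i, 0 ≤ c i) ∧ (∀ i, c i ≤ 1) ∧ ∑ i, c i = M.trace ∧
      (H * M).trace = ∑ i, c i * f i := by
  obtain ⟨U, h1, h2, rfl⟩ := spec_aux hH f hf
  refine ⟨fun i => (Uᴴ * M * U) i i, fun i => ?_, fun i => ?_, ?_, ?_⟩
  · exact (hM.conjTranspose_mul_mul_same U).diag_nonneg
  · have := (hM'.conjTranspose_mul_mul_same U).diag_nonneg (i := i)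
    rw [mul_sub, sub_mul, mul_one, h2] at this
    simpa using this
  · change (Uᴴ * M * U).trace = _
    rw [trace_mul_comm, ← mul_assoc, h1, one_mul]
  · have : (U * diagonal f * Uᴴ * M).trace = ((Uᴴ * M * U) * diagonal f).trace := by
      rw [mul_assoc, mul_assoc, trace_mul_comm, mul_assoc, trace_mul_comm]
    rw [this]
    simp [trace, mul_diagonal]

open Matrix in
lemma trace_bottom {n : ℕ} {H M : Matrix (Fin n) (Fin n) ℝ} (hH : H.IsHermitian) (f : Fin n → ℝ)
    (hf : ∃ e : Equiv.Perm (Fin n), f = hH.eigenvalues ∘ e) (ha : Antitone f)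
    (hM : M.PosSemidef) (hM' : (1 - M).PosSemidef) (m : ℕ) (hm1 : 1 ≤ m) (hmn : m ≤ n)
    (ht : M.trace = m)
    (hc : (Finset.univ.filter (fun i : Fin n => n - m ≤ (i : ℕ))).card = m) :
    ∑ i ∈ Finset.univ.filter (fun i : Fin n => n - m ≤ (i : ℕ)), f i ≤ (H * M).trace := by
  obtain ⟨c, h0, h1, hs, he⟩ := trace_weights hH f hf hM hM'
  rw [he]
  refine weights_aux _ f c (f ⟨n - m, by omega⟩) h0 h1 (by rw [hs, ht, hc]) ?_ ?_
  · intro i hi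
    exact ha (by simpa [Fin.le_def] using hi)
  · intro i hi
    refine ha ?_
    simp at hi
    simp only [Fin.le_def]; omega

open Matrix in
lemma trace_top {n : ℕ} {H M : Matrix (Fin n) (Fin n) ℝ} (hH : H.IsHermitian) (f : Fin n → ℝ)
    (hf : ∃ e : Equiv.Perm (Fin n), f = hH.eigenvalues ∘ e) (ha : Antitone f)
    (hM : M.PosSemidef) (hM' : (1 - M).PosSemidef) (m : ℕ) (hm1 : 1 ≤ m) (hmn : m ≤ n)
    (ht : M.trace = m)
    (hc : (Finset.univ.filter (fun i : Fin n => (i : ℕ) < m)).card = m) :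
    (H * M).trace ≤ ∑ i ∈ Finset.univ.filter (fun i : Fin n => (i : ℕ) < m), f i := by
  obtain ⟨c, h0, h1, hs, he⟩ := trace_weights hH f hf hM hM'
  rw [he]
  have := weights_aux (Finset.univ.filter (fun i : Fin n => (i : ℕ) < m)) (fun i => - f i) c
    (- f ⟨m - 1, by omega⟩) h0 h1 (by rw [hs, ht, hc]) ?_ ?_
  · simp only [mul_neg, Finset.sum_neg_distrib] at this
    linarith
  · intro i hi
    refine neg_le_neg (ha ?_)
    simp at hi
    simp only [Fin.le_def]; omega
  · intro i hi
    refine neg_le_neg (ha ?_)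
    simp at hi
    simp only [Fin.le_def]; omega

open Matrix in
lemma exists_proj {n : ℕ} {H : Matrix (Fin n) (Fin n) ℝ} (hH : H.IsHermitian) (f : Fin n → ℝ)
    (hf : ∃ e : Equiv.Perm (Fin n), f = hH.eigenvalues ∘ e) (s : Finset (Fin n)) :
    ∃ P : Matrix (Fin n) (Fin n) ℝ, P.PosSemidef ∧ (1 - P).PosSemidef ∧ P.trace = s.card ∧
      (H * P).trace = ∑ i ∈ s, f i := by
  obtain ⟨U, h1, h2, rfl⟩ := spec_aux hH f hf
  let d : Fin n → ℝ := fun i => if i ∈ s then 1 else 0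
  refine ⟨U * diagonal d * Uᴴ, ?_, ?_, ?_, ?_⟩
  · refine PosSemidef.mul_mul_conjTranspose_same (PosSemidef.diagonal ?_) U
    intro i; simp only [d]; split_ifs <;> simp
  · have : 1 - U * diagonal d * Uᴴ = U * diagonal (fun i => 1 - d i) * Uᴴ := by
      have : diagonal (fun i => 1 - d i) = 1 - diagonal d := by
        rw [← diagonal_one, diagonal_sub]
      rw [this, mul_sub, sub_mul, mul_one, h1]
    rw [this]
    refine PosSemidef.mul_mul_conjTranspose_same (PosSemidef.diagonal ?_) U
    intro i; simp only [d]; split_ifs <;> simp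
  · rw [trace_mul_comm, ← mul_assoc, h2, one_mul]
    simp [d, trace_diagonal]
  · have : U * diagonal f * Uᴴ * (U * diagonal d * Uᴴ) = U * (diagonal f * diagonal d) * Uᴴ := by
      calc _ = U * diagonal f * (Uᴴ * U) * diagonal d * Uᴴ := by simp only [mul_assoc]
        _ = _ := by rw [h2]; simp only [mul_assoc, mul_one]
    rw [this, trace_mul_comm, ← mul_assoc, h2, one_mul, diagonal_mul_diagonal]
    simp [d, trace_diagonal]

open Matrix in
lemma simplex_psd (k : ℕ) (hk : 2 ≤ k) :
    (Matrix.of fun c d : Fin k => if c = d then (1 : ℝ) else -1 / ((k : ℝ) - 1)).PosSemidef := by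
  have hk' : (2 : ℝ) ≤ k := by exact_mod_cast hk
  refine PosSemidef.of_dotProduct_mulVec_nonneg ?_ ?_
  · ext i j
    simp [eq_comm]
  · intro x
    have hcs := sq_sum_le_card_mul_sum_sq (s := Finset.univ) (f := x)
    simp only [Finset.card_univ, Fintype.card_fin] at hcs
    have e : star x ⬝ᵥ ((Matrix.of fun c d : Fin k =>
        if c = d then (1 : ℝ) else -1 / ((k : ℝ) - 1)) *ᵥ x)
        = (k * ∑ i, x i ^ 2 - (∑ i, x i) ^ 2) / ((k : ℝ) - 1) := by
      have h1 : ∀ i, ((Matrix.of fun c d : Fin k =>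
          if c = d then (1 : ℝ) else -1 / ((k : ℝ) - 1)) *ᵥ x) i
          = (k * x i - ∑ j, x j) / ((k : ℝ) - 1) := by
        intro i
        have : ∀ j, (if i = j then (1 : ℝ) else -1 / ((k : ℝ) - 1)) * x j
            = (if i = j then (k / ((k : ℝ) - 1)) * x j else 0) - x j / ((k : ℝ) - 1) := by
          intro j
          have : (k : ℝ) - 1 ≠ 0 := by linarith
          split_ifs
          · field_simp
          · ring
        simp only [mulVec, dotProduct, Matrix.of_apply, this, Finset.sum_sub_distrib,
          ← Finset.sum_div]
        simp
        ring
      simp only [dotProduct, h1, Pi.star_apply, star_trivial]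
      rw [sq, Finset.sum_mul, Finset.mul_sum, ← Finset.sum_sub_distrib, Finset.sum_div]
      exact Finset.sum_congr rfl fun i _ => by ring
    rw [e]
    apply div_nonneg <;> linarith


/-- **Second generalized Kolotilina bound.** For a finite simple graph `G` on `n` vertices with
at least one edge and chromatic number `χ`, for every `1 ≤ m ≤ n`:
`Σ_{i=1}^m μ_i ≤ (χ - 1)·Σ_{i=1}^m (μ_i - δ_{n+1-i} + θ_{n+1-i})`.
Here `μ`, `θ`, `δ` are the non-increasing enumerations of the eigenvalues of the adjacency
matrix, the Laplacian `L = D - A` and the signless Laplacian `Q = D + A`, respectively;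
`Σ_{i=1}^m μ_i` is the sum over indices `< m` and `Σ_{i=1}^m δ_{n+1-i}` (resp. for `θ`) is
the sum over indices `≥ n - m`. -/
theorem stmt_11 {n : ℕ} (hn : 0 < n) (G : SimpleGraph (Fin n)) [DecidableRel G.Adj]
    (he : ∃ v w : Fin n, G.Adj v w)
    (χ : ℕ) (hχ : G.chromaticNumber = (χ : ℕ∞))
    (hA : (G.adjMatrix ℝ).IsHermitian)
    (hL : (G.lapMatrix ℝ).IsHermitian)
    (hQ : (G.degMatrix ℝ + G.adjMatrix ℝ).IsHermitian)
    (μ θ δ : Fin n → ℝ)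
    (hμa : Antitone μ) (hμ : ∃ e : Equiv.Perm (Fin n), μ = hA.eigenvalues ∘ e)
    (hθa : Antitone θ) (hθ : ∃ e : Equiv.Perm (Fin n), θ = hL.eigenvalues ∘ e)
    (hδa : Antitone δ) (hδ : ∃ e : Equiv.Perm (Fin n), δ = hQ.eigenvalues ∘ e)
    (m : ℕ) (hm1 : 1 ≤ m) (hmn : m ≤ n) :
    (∑ i ∈ Finset.univ.filter (fun i : Fin n => (i : ℕ) < m), μ i) ≤
      ((χ : ℝ) - 1) *
        ((∑ i ∈ Finset.univ.filter (fun i : Fin n => (i : ℕ) < m), μ i) -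
          (∑ i ∈ Finset.univ.filter (fun i : Fin n => n - m ≤ (i : ℕ)), δ i) +
          (∑ i ∈ Finset.univ.filter (fun i : Fin n => n - m ≤ (i : ℕ)), θ i)) := by
  classical
  obtain ⟨v, w, hvw⟩ := he
  have hχ2 : 2 ≤ χ := by
    have := SimpleGraph.two_le_chromaticNumber_of_adj hvw
    rw [hχ] at this
    exact_mod_cast this
  have hχ2' : (2 : ℝ) ≤ χ := by exact_mod_cast hχ2
  obtain ⟨C⟩ := SimpleGraph.chromaticNumber_le_iff_colorable.mp hχ.le
  have hcT : (Finset.univ.filter (fun i : Fin n => (i : ℕ) < m)).card = m := by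
    rw [Fin.card_filter_val_lt]; omega
  have hcB : (Finset.univ.filter (fun i : Fin n => n - m ≤ (i : ℕ))).card = m := by
    have h := Finset.card_filter_add_card_filter_not (s := (Finset.univ : Finset (Fin n)))
      (fun i : Fin n => (i : ℕ) < n - m)
    simp only [not_lt, Finset.card_univ, Fintype.card_fin] at h
    rw [Fin.card_filter_val_lt] at h
    omega
  obtain ⟨P, hP, hP', hPt, hPL⟩ := exists_proj hL θ hθ
    (Finset.univ.filter (fun i : Fin n => n - m ≤ (i : ℕ)))
  rw [hcB] at hPt
  let S : Matrix (Fin n) (Fin n) ℝ :=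
    (Matrix.of fun c d : Fin χ => if c = d then (1 : ℝ) else -1 / ((χ : ℝ) - 1)).submatrix C C
  have hS : S.PosSemidef := (simplex_psd χ hχ2).submatrix C
  have hSd : ∀ i, S i i = 1 := fun i => by simp [S]
  have hM : (Matrix.hadamard P S).PosSemidef := hP.hadamard hS
  have hM' : (1 - Matrix.hadamard P S).PosSemidef := by
    have : 1 - Matrix.hadamard P S = Matrix.hadamard (1 - P) S := by
      ext i j
      by_cases hij : i = j
      · subst hij; simp [Matrix.hadamard_apply, hSd]
      · simp [Matrix.hadamard_apply, hij]
    rw [this]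
    exact hP'.hadamard hS
  have hMt : (Matrix.hadamard P S).trace = m := by
    rw [← hPt]
    simp [Matrix.trace, hSd]
  have hq := trace_bottom hQ δ hδ hδa hM hM' m hm1 hmn hMt hcB
  have ha := trace_top hA μ hμ hμa hP hP' m hm1 hmn hPt hcT
  have hD : (G.degMatrix ℝ * Matrix.hadamard P S).trace = (G.degMatrix ℝ * P).trace := by
    simp [SimpleGraph.degMatrix, Matrix.trace, Matrix.diagonal_mul, hSd]
  have hAM : (G.adjMatrix ℝ * Matrix.hadamard P S).trace
      = -1 / ((χ : ℝ) - 1) * (G.adjMatrix ℝ * P).trace := by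
    simp only [Matrix.trace, Matrix.diag_apply, Matrix.mul_apply, Finset.mul_sum]
    refine Finset.sum_congr rfl fun i _ => Finset.sum_congr rfl fun j _ => ?_
    by_cases hij : G.Adj i j
    · have : C j ≠ C i := (C.valid hij).symm
      simp [S, hij, this]
      ring
    · simp [hij]
  rw [add_mul, Matrix.trace_add, hD, hAM] at hq
  rw [SimpleGraph.lapMatrix, sub_mul, Matrix.trace_sub] at hPL
  set a := (G.adjMatrix ℝ * P).trace
  set d := (G.degMatrix ℝ * P).trace
  have hpos : (0 : ℝ) < χ - 1 := by linarith
  have hq2 := mul_le_mul_of_nonneg_left hq hpos.le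
  have e : ((χ : ℝ) - 1) * (d + -1 / ((χ : ℝ) - 1) * a) = (χ - 1) * d - a := by
    field_simp
    ring
  rw [e] at hq2
  have ha2 := mul_le_mul_of_nonneg_left ha (by linarith : (0 : ℝ) ≤ χ - 2)
  rw [← hPL]
  nlinarith
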